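/- Let G' be a graph whose vertex set is partitioned as V ∪ U, and let S ⊆ V ∪ U with S_V = S ∩ V and S_U = S ∩ U, where all edges incident to U go between U and V. If vol(S_V) < vol(S_U)/2, then δ(S)/vol(S) ≥ 1/3. -/

import Mathlib

open Finset
open scoped Classical

variable {X : Type*} [Fintype X]

/-- Number of edges leaving `S` (each crossing edge counted once, from the `S` side). -/
noncomputable def cutSize (G : SimpleGraph X) (S : Finset X) : ℕ :=
  ∑ u ∈ S, (G.neighborFinset u \ S).card

/-- The volume of `S`: sum of degrees of its vertices. -/
noncomputable def vol (G : SimpleGraph X) (S : Finset X) : ℕ :=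
  ∑ u ∈ S, G.degree u

/-- The edges between an independent set and the rest of `S`, counted from the independent side,
number at most the volume of the rest. -/
lemma sum_card_neighborFinset_inter_le_vol (G : SimpleGraph X) (U : Finset X)
    (hU : ∀ u ∈ U, ∀ w, G.Adj u w → w ∉ U) (S : Finset X) :
    ∑ u ∈ S ∩ U, (G.neighborFinset u ∩ S).card ≤ vol G (S \ U) := by
  calc ∑ u ∈ S ∩ U, (G.neighborFinset u ∩ S).card
      = ∑ u ∈ S ∩ U, ((S \ U).bipartiteAbove G.Adj u).card := by
        refine sum_congr rfl fun u hu => congrArg card ?_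
        ext w
        have := hU u (mem_inter.mp hu).2 w
        simp only [mem_inter, SimpleGraph.mem_neighborFinset, mem_bipartiteAbove, mem_sdiff]
        tauto
    _ = ∑ w ∈ S \ U, ((S ∩ U).bipartiteBelow G.Adj w).card :=
        sum_card_bipartiteAbove_eq_sum_card_bipartiteBelow _
    _ ≤ vol G (S \ U) := by
        refine sum_le_sum fun w _ => ?_
        rw [← SimpleGraph.card_neighborFinset_eq_degree]
        refine card_le_card fun u hu => ?_
        rw [SimpleGraph.mem_neighborFinset]
        exact ((mem_bipartiteBelow _).mp hu).2.symm

lemma vol_inter_le_cutSize_add_vol_sdiff (G : SimpleGraph X) (U : Finset X)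
    (hU : ∀ u ∈ U, ∀ w, G.Adj u w → w ∉ U) (S : Finset X) :
    vol G (S ∩ U) ≤ cutSize G S + vol G (S \ U) := by
  calc vol G (S ∩ U)
      = ∑ u ∈ S ∩ U, (G.neighborFinset u \ S).card +
          ∑ u ∈ S ∩ U, (G.neighborFinset u ∩ S).card := by
        rw [← sum_add_distrib]
        refine sum_congr rfl fun u _ => ?_
        rw [card_sdiff_add_card_inter, SimpleGraph.card_neighborFinset_eq_degree]
    _ ≤ cutSize G S + vol G (S \ U) :=
        add_le_add (sum_le_sum_of_subset inter_subset_left)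
          (sum_card_neighborFinset_inter_le_vol G U hU S)

lemma vol_inter_add_vol_sdiff (G : SimpleGraph X) (U S : Finset X) :
    vol G (S ∩ U) + vol G (S \ U) = vol G S :=
  sum_inter_add_sum_sdiff S U _

/-- If the vertex set is partitioned into `V = Uᶜ` and `U`, all edges incident to `U` go
between `U` and `V` (so `U` is independent), and `vol(S_V) < vol(S_U)/2`, then
`δ(S)/vol(S) ≥ 1/3`. -/
theorem cut_ratio_ge_third (G : SimpleGraph X) (U : Finset X)
    (hU : ∀ u ∈ U, ∀ w, G.Adj u w → w ∉ U)
    (S : Finset X)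
    (hvol : (vol G (S \ U) : ℝ) < (vol G (S ∩ U) : ℝ) / 2) :
    (cutSize G S : ℝ) / (vol G S : ℝ) ≥ 1 / 3 := by
  have hcut : (vol G (S ∩ U) : ℝ) ≤ cutSize G S + vol G (S \ U) := by
    exact_mod_cast vol_inter_le_cutSize_add_vol_sdiff G U hU S
  have hsplit : (vol G (S ∩ U) : ℝ) + vol G (S \ U) = vol G S := by
    exact_mod_cast vol_inter_add_vol_sdiff G U S
  have hnonneg : (0 : ℝ) ≤ vol G (S \ U) := Nat.cast_nonneg _
  rw [ge_iff_le, le_div_iff₀ (by linarith)]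
  linarith
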